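/- Let m ≥ 2, 0 ≤ u < v ≤ m, let M be a natural number, and let F01, F11, F02, F12 be positive reals. For binary patterns i, i′ of length m, let W(i,i′) be the product of w(e) over all unordered pairs e of distinct positions in {1,…,m}. Then the sum, over all ordered pairs (i,i′) with weight(i) = u and weight(i′) = v, of W(i,i′)^M equals the sum over t = v,…,min(u+v, m) of C(m,t)·C(t,v)·C(v, (u+v)−t) · ( F01^(d(2m−(u+v)−d)/2) · F11^((d²−(v−u)²)/4) · F02^((d(d−2)+(v−u)²)/4) · F12^(d((u+v)−d)/2) )^M, where d = 2t−(u+v) and C(·,·) is the binomial coefficient. -/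

import Mathlib

open Finset
open scoped Classical

/-- The weight of a binary pattern: the number of positions where it equals `true`. -/
def wt {α : Type*} [Fintype α] (i : α → Bool) : ℕ :=
  (Finset.univ.filter fun a => i a = true).card

/-- Restricted weight of a pattern on a pair of positions: `i_a + i_b ∈ {0,1,2}`. -/
def rwt {α : Type*} (i : α → Bool) (a b : α) : ℕ :=
  (i a).toNat + (i b).toNat

/-- The two-mode sub-fidelity weight of a pair of distinct positions `{a,b}`:
`1` if the restrictions of `i` and `i'` coincide; `F01` if the unordered pair of
restricted weights is `{0,1}`; `F11` if both restricted weights are `1` but the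
restrictions differ; `F02` for restricted weights `{0,2}`; `F12` for `{1,2}`. -/
noncomputable def w {α : Type*} (F01 F11 F02 F12 : ℝ) (i i' : α → Bool) (a b : α) : ℝ :=
  if (i a, i b) = (i' a, i' b) then 1
  else if rwt i a b + rwt i' a b = 1 then F01
  else if rwt i a b + rwt i' a b = 3 then F12
  else if rwt i a b = 1 then F11
  else F02

/-- Product of `w` over all unordered pairs `{a,b}` of distinct positions
(the `k_max = m-1` local-nearest-neighbour probe-domain distribution). -/
noncomputable def Wfull {m : ℕ} (F01 F11 F02 F12 : ℝ) (i i' : Fin m → Bool) : ℝ :=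
  ∏ p ∈ Finset.univ.filter (fun p : Fin m × Fin m => p.1 < p.2),
    w F01 F11 F02 F12 i i' p.1 p.2

/-- The set of positions where a pattern equals `true`. -/
def support {α : Type*} [Fintype α] (i : α → Bool) : Finset α :=
  Finset.univ.filter fun a => i a = true

@[simp] lemma mem_support {α : Type*} [Fintype α] (i : α → Bool) (a : α) :
    a ∈ support i ↔ i a = true := by
  simp [support]

lemma support_decide {α : Type*} [Fintype α] (s : Finset α) [DecidablePred (· ∈ s)] :
    support (fun a => decide (a ∈ s)) = s := by
  ext a; simp

lemma card_support {α : Type*} [Fintype α] (i : α → Bool) : (support i).card = wt i := rfl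

lemma sdiff_union_union_of_subset {α : Type*} [DecidableEq α] {T B C : Finset α}
    (hBT : B ⊆ T) (hCB : C ⊆ B) : T \ B ∪ C ∪ B = T := by
  rw [Finset.union_assoc, Finset.union_eq_right.2 hCB, Finset.sdiff_union_of_subset hBT]

/-- The number of pairs of patterns of weights `u` and `v` whose supports have a union of
size `t`. -/
lemma card_pairs_union {m u v t : ℕ} (hvt : v ≤ t) (htuv : t ≤ u + v) :
    (Finset.univ.filter fun q : (Fin m → Bool) × (Fin m → Bool) =>
      (wt q.1 = u ∧ wt q.2 = v) ∧ (support q.1 ∪ support q.2).card = t).card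
      = m.choose t * t.choose v * v.choose ((u + v) - t) := by
  have hR : ((Finset.powersetCard t (Finset.univ : Finset (Fin m))).sigma fun T =>
      (Finset.powersetCard v T).sigma fun B => Finset.powersetCard ((u + v) - t) B).card
      = m.choose t * t.choose v * v.choose ((u + v) - t) := by
    have hB : ∀ T ∈ Finset.powersetCard t (Finset.univ : Finset (Fin m)),
        ((Finset.powersetCard v T).sigma fun B =>
          Finset.powersetCard ((u + v) - t) B).card
          = t.choose v * v.choose ((u + v) - t) := by
      intro T hT
      have hC : ∀ B ∈ Finset.powersetCard v T,
          (Finset.powersetCard ((u + v) - t) B).card = v.choose ((u + v) - t) := by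
        intro B hB
        rw [Finset.card_powersetCard, (Finset.mem_powersetCard.1 hB).2]
      rw [Finset.card_sigma, Finset.sum_const_nat hC, Finset.card_powersetCard,
        (Finset.mem_powersetCard.1 hT).2]
    rw [Finset.card_sigma, Finset.sum_const_nat hB, Finset.card_powersetCard, Finset.card_univ,
      Fintype.card_fin, mul_assoc]
  rw [← hR]
  refine Finset.card_nbij'
    (fun q => ⟨support q.1 ∪ support q.2, support q.2, support q.1 ∩ support q.2⟩)
    (fun x => (fun a => decide (a ∈ (x.1 \ x.2.1) ∪ x.2.2), fun a => decide (a ∈ x.2.1)))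
    ?_ ?_ ?_ ?_
  · rintro ⟨i, j⟩ h
    simp only [Finset.coe_filter, Finset.mem_univ, true_and, Set.mem_ofPred_eq] at h
    obtain ⟨⟨hu, hv⟩, ht⟩ := h
    have := Finset.card_union_add_card_inter (support i) (support j)
    rw [card_support, card_support] at this
    simp only [Finset.mem_coe, Finset.mem_sigma, Finset.mem_powersetCard]
    exact ⟨⟨Finset.subset_univ _, ht⟩, ⟨Finset.subset_union_right, hv⟩,
      Finset.inter_subset_right, by omega⟩
  · rintro ⟨T, B, C⟩ h
    simp only [Finset.mem_coe, Finset.mem_sigma, Finset.mem_powersetCard] at h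
    obtain ⟨⟨-, hT⟩, ⟨hBT, hB⟩, hCB, hC⟩ := h
    simp only [Finset.coe_filter, Finset.mem_univ, true_and, Set.mem_ofPred_eq]
    simp only [← card_support, support_decide]
    have hd : Disjoint (T \ B) C := Finset.disjoint_sdiff.symm.mono_right hCB
    have hU := sdiff_union_union_of_subset hBT hCB
    refine ⟨⟨?_, hB⟩, by rw [hU, hT]⟩
    rw [Finset.card_union_of_disjoint hd, Finset.card_sdiff_of_subset hBT]
    omega
  · rintro ⟨i, j⟩ -
    ext a
    · cases hi : i a <;> cases hj : j a <;> simp [hi, hj]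
    · simp
  · rintro ⟨T, B, C⟩ h
    simp only [Finset.mem_coe, Finset.mem_sigma, Finset.mem_powersetCard] at h
    obtain ⟨-, ⟨hBT, -⟩, hCB, -⟩ := h
    have hU := sdiff_union_union_of_subset hBT hCB
    have hI : (T \ B ∪ C) ∩ B = C := by
      ext a
      have := @hCB a
      simp only [Finset.mem_union, Finset.mem_inter, Finset.mem_sdiff]
      tauto
    simp only [support_decide, hU, hI]

lemma w_pos {α : Type*} {F01 F11 F02 F12 : ℝ} (hF01 : 0 < F01) (hF11 : 0 < F11)
    (hF02 : 0 < F02) (hF12 : 0 < F12) (i j : α → Bool) (a b : α) :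
    0 < w F01 F11 F02 F12 i j a b := by
  unfold w
  split_ifs <;> first | assumption | exact one_pos

lemma w_comm {α : Type*} (F01 F11 F02 F12 : ℝ) (i j : α → Bool) (a b : α) :
    w F01 F11 F02 F12 i j a b = w F01 F11 F02 F12 i j b a := by
  unfold w rwt
  cases i a <;> cases i b <;> cases j a <;> cases j b <;> simp

/-- The product of a symmetric function over all ordered pairs, in terms of the product over
unordered pairs and the diagonal. -/
lemma prod_prod_eq_sq_mul_diag {α R : Type*} [Fintype α] [LinearOrder α] [CommMonoid R]
    (f : α → α → R) (hf : ∀ a b, f a b = f b a) :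
    ∏ a, ∏ b, f a b
      = (∏ p ∈ Finset.univ.filter (fun p : α × α => p.1 < p.2), f p.1 p.2) ^ 2
        * ∏ a, f a a := by
  have hgt : ∏ p ∈ Finset.univ.filter (fun p : α × α => p.2 < p.1), f p.1 p.2
      = ∏ p ∈ Finset.univ.filter (fun p : α × α => p.1 < p.2), f p.1 p.2 :=
    Finset.prod_nbij' Prod.swap Prod.swap (by simp) (by simp) (by simp) (by simp)
      (fun p _ => hf _ _)
  have hdiag : ∏ p ∈ Finset.univ.filter (fun p : α × α => p.1 = p.2), f p.1 p.2
      = ∏ a, f a a :=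
    Finset.prod_nbij' Prod.fst (fun a => (a, a)) (by simp) (by simp)
      (by rintro ⟨a, b⟩ h; simpa using h) (by simp)
      (by rintro ⟨a, b⟩ h; obtain rfl : a = b := by simpa using h
          rfl)
  rw [← Fintype.prod_prod_type' f,
    ← Finset.prod_filter_mul_prod_filter_not Finset.univ (fun p : α × α => p.1 < p.2),
    ← Finset.prod_filter_mul_prod_filter_not
      (Finset.univ.filter fun p : α × α => ¬ p.1 < p.2) (fun p : α × α => p.2 < p.1),
    Finset.filter_filter, Finset.filter_filter, sq, mul_assoc]
  congr 1
  rw [← hgt, ← hdiag]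
  congr 1
  · refine Finset.prod_congr (Finset.filter_congr fun p _ => ?_) fun _ _ => rfl
    exact ⟨fun h => h.2, fun h => ⟨h.not_gt, h⟩⟩
  · refine Finset.prod_congr (Finset.filter_congr fun p _ => ?_) fun _ _ => rfl
    exact ⟨fun h => le_antisymm (not_lt.1 h.2) (not_lt.1 h.1),
      fun h => ⟨h.not_lt, h.symm.not_lt⟩⟩

/-- A product over positions of a function of the two patterns, grouped by their values. -/
lemma prod_pattern {α : Type*} [Fintype α] [DecidableEq α] (i j : α → Bool) (g : Bool → Bool → ℝ) :
    ∏ a, g (i a) (j a)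
      = g true true ^ (support i ∩ support j).card * g true false ^ (support i \ support j).card
        * g false true ^ (support j \ support i).card
        * g false false ^ (support i ∪ support j)ᶜ.card := by
  have h := Finset.prod_fiberwise' Finset.univ (fun a => (i a, j a)) fun x => g x.1 x.2
  simp only [Finset.prod_const] at h
  rw [← h, Fintype.prod_prod_type]
  simp only [Fintype.prod_bool, Prod.mk.injEq]
  rw [← mul_assoc]
  congr 4 <;> congr 1 <;> (ext a; cases hi : i a <;> cases hj : j a <;> simp [hi, hj])

lemma Wfull_eq {m : ℕ} {F01 F11 F02 F12 : ℝ} (hF01 : 0 < F01) (hF11 : 0 < F11)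
    (hF02 : 0 < F02) (hF12 : 0 < F12) (i j : Fin m → Bool) {a b c n e : ℕ}
    (ha : (support i \ support j).card = a) (hb : (support j \ support i).card = b)
    (hc : (support i ∩ support j).card = c) (hn : (support i ∪ support j)ᶜ.card = n)
    (he : a ^ 2 + b ^ 2 = a + b + 2 * e) :
    Wfull F01 F11 F02 F12 i j
      = F01 ^ ((a + b) * n) * F11 ^ (a * b) * F02 ^ e * F12 ^ ((a + b) * c) := by
  have hW : 0 < Wfull F01 F11 F02 F12 i j :=
    Finset.prod_pos fun p _ => w_pos hF01 hF11 hF02 hF12 i j p.1 p.2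
  have key := prod_prod_eq_sq_mul_diag (w F01 F11 F02 F12 i j) (w_comm F01 F11 F02 F12 i j)
  have hdiag : ∏ p, w F01 F11 F02 F12 i j p p = F02 ^ (a + b) := by
    have := prod_pattern i j fun x y => if x = y then 1 else F02
    rw [ha, hb, hc, hn] at this
    simp only [Bool.false_eq_true, Bool.true_eq_false, if_true, if_false, one_pow, one_mul, mul_one]
      at this
    rw [pow_add, ← this]
    refine Finset.prod_congr rfl fun p _ => ?_
    unfold w rwt
    cases i p <;> cases j p <;> simp
  let g : Bool → Bool → Bool → Bool → ℝ := fun x y x' y' =>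
    w F01 F11 F02 F12 (fun z : Bool => if z then x else x') (fun z => if z then y else y')
      true false
  have hg : ∀ p q, w F01 F11 F02 F12 i j p q = g (i p) (j p) (i q) (j q) := by
    intro p q
    simp only [g, w, rwt, Prod.mk.injEq, if_true, if_false, Bool.false_eq_true]
    congr!
  have hall : ∏ p, ∏ q, w F01 F11 F02 F12 i j p q
      = (F01 ^ ((a + b) * n) * F11 ^ (a * b) * F02 ^ e * F12 ^ ((a + b) * c)) ^ 2
        * F02 ^ (a + b) := by
    simp only [hg]
    simp only [fun p => prod_pattern i j (g (i p) (j p))]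
    rw [prod_pattern i j fun x y => g x y true true ^ (support i ∩ support j).card
      * g x y true false ^ (support i \ support j).card
      * g x y false true ^ (support j \ support i).card
      * g x y false false ^ (support i ∪ support j)ᶜ.card]
    rw [ha, hb, hc, hn]
    have h2 : F02 ^ (a ^ 2 + b ^ 2) = F02 ^ (a + b + 2 * e) := by rw [he]
    simp [g, w, rwt]
    trans F01 ^ (2 * ((a + b) * n)) * F11 ^ (2 * (a * b)) * F02 ^ (a ^ 2 + b ^ 2)
      * F12 ^ (2 * ((a + b) * c))
    · ring
    · rw [h2]; ring
  rw [hall, hdiag] at key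
  have h := mul_right_cancel₀ (pow_pos hF02 _).ne' key
  exact (pow_left_inj₀ hW.le (by positivity) two_ne_zero).1 h.symm

lemma sq_add_sq_eq_add_add (a k : ℕ) :
    a ^ 2 + (a + k + 1) ^ 2 = a + (a + k + 1)
      + 2 * (((a + (a + k + 1)) * (a + (a + k + 1) - 2) + (k + 1) ^ 2) / 4) := by
  obtain ⟨x, hx⟩ := Nat.even_mul_succ_self a
  obtain ⟨y, hy⟩ := Nat.even_mul_succ_self (a + k)
  rcases Nat.eq_zero_or_pos (a + k) with h | h
  · obtain ⟨rfl, rfl⟩ : a = 0 ∧ k = 0 := by omega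
    simp
  · obtain ⟨s, hs⟩ : ∃ s, a + (a + k + 1) = s + 2 := ⟨2 * a + k - 1, by omega⟩
    have hE : (a + (a + k + 1)) * (a + (a + k + 1) - 2) + (k + 1) ^ 2 = 4 * (x + y - a) := by
      have hxa : a ≤ x + y := by nlinarith
      obtain ⟨z, hz⟩ := Nat.exists_eq_add_of_le hxa
      rw [hz, Nat.add_sub_cancel_left, hs, Nat.add_sub_cancel]
      have hs' : s + 1 = 2 * a + k := by omega
      zify at *
      have hs2 : (s : ℤ) = 2 * a + k - 1 := by linarith
      rw [hs2]
      linear_combination 2 * hx + 2 * hy + 4 * hz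
    rw [hE, Nat.mul_div_cancel_left _ (by norm_num)]
    have hxa : a ≤ x + y := by nlinarith
    zify [hxa] at *
    nlinarith

/-- Cross-term error quantity of the `M`-copy `k_max`-LNN protocol between the
`u`-CPF and `v`-CPF image spaces (`u < v`), re-parameterised as a sum over
`t = v,…,min(u+v,m)` with `d = 2t-(u+v)`. -/
theorem stmt12 (m u v : ℕ) (hm : 2 ≤ m) (huv : u < v) (hvm : v ≤ m) (M : ℕ)
    (F01 F11 F02 F12 : ℝ)
    (hF01 : 0 < F01) (hF11 : 0 < F11) (hF02 : 0 < F02) (hF12 : 0 < F12) :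
    ∑ q ∈ (Finset.univ : Finset ((Fin m → Bool) × (Fin m → Bool))).filter
        (fun q => wt q.1 = u ∧ wt q.2 = v),
        (Wfull F01 F11 F02 F12 q.1 q.2) ^ M
      = ∑ t ∈ Finset.Icc v (min (u + v) m),
          (m.choose t * t.choose v * v.choose ((u + v) - t) : ℝ) *
            ((fun d : ℕ =>
              F01 ^ (d * (2 * m - (u + v) - d) / 2) *
                F11 ^ ((d ^ 2 - (v - u) ^ 2) / 4) *
                F02 ^ ((d * (d - 2) + (v - u) ^ 2) / 4) *
                F12 ^ (d * ((u + v) - d) / 2)) (2 * t - (u + v))) ^ M := by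
  rw [← Finset.sum_fiberwise_of_maps_to (t := Finset.Icc v (min (u + v) m))
    (g := fun q => (support q.1 ∪ support q.2).card)]
  · refine Finset.sum_congr rfl fun t ht => ?_
    rw [Finset.mem_Icc, le_min_iff] at ht
    obtain ⟨hvt, htuv, htm⟩ := ht
    rw [Finset.filter_filter, Finset.sum_congr rfl (g := fun _ => _), Finset.sum_const,
      card_pairs_union hvt htuv, nsmul_eq_mul]
    · push_cast
      rfl
    · rintro ⟨i, j⟩ h
      simp only [Finset.mem_filter, Finset.mem_univ, true_and] at h
      simp only [← card_support] at h
      obtain ⟨⟨hu, hv⟩, hT⟩ := h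
      obtain ⟨a, rfl⟩ := Nat.exists_eq_add_of_le hvt
      obtain ⟨k, rfl⟩ := Nat.exists_eq_add_of_lt huv
      obtain ⟨n, rfl⟩ := Nat.exists_eq_add_of_le htm
      obtain ⟨c, rfl⟩ : ∃ c, u = a + c := Nat.exists_eq_add_of_le (by omega)
      have h1 := Finset.card_union_add_card_inter (support i) (support j)
      have h2 := Finset.card_sdiff_add_card_inter (support i) (support j)
      have h3 := Finset.card_sdiff_add_card_inter (support j) (support i)
      rw [Finset.inter_comm] at h3
      have h4 := Finset.card_add_card_compl (support i ∪ support j)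
      rw [Fintype.card_fin] at h4
      have e1 : 2 * (a + c + k + 1 + a) - (a + c + (a + c + k + 1)) = a + (a + k + 1) := by omega
      have e2 : 2 * (a + c + k + 1 + a + n) - (a + c + (a + c + k + 1)) - (a + (a + k + 1))
        = 2 * n := by omega
      have e3 : a + c + (a + c + k + 1) - (a + (a + k + 1)) = 2 * c := by omega
      have e4 : a + c + k + 1 - (a + c) = k + 1 := by omega
      have e5 : (a + (a + k + 1)) ^ 2 - (k + 1) ^ 2 = 4 * (a * (a + k + 1)) := by
        rw [Nat.sub_eq_iff_eq_add (Nat.pow_le_pow_left (by omega) 2)]; ring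
      simp only [e1, e2, e3, e4, e5, Nat.mul_div_cancel_left _ (show 0 < 4 by norm_num)]
      rw [Wfull_eq hF01 hF11 hF02 hF12 i j (a := a) (b := a + k + 1) (c := c) (n := n)
        (by omega) (by omega) (by omega) (by omega) (sq_add_sq_eq_add_add a k)]
      congr 5 <;> (rw [Nat.mul_left_comm]; simp)
  · rintro ⟨i, j⟩ h
    simp only [Finset.mem_filter, Finset.mem_univ, true_and] at h
    simp only [← card_support] at h
    obtain ⟨hu, hv⟩ := h
    rw [Finset.mem_Icc, le_min_iff, ← hu, ← hv]
    exact ⟨Finset.card_le_card Finset.subset_union_right, Finset.card_union_le _ _,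
      (Finset.card_le_univ _).trans_eq (Fintype.card_fin m)⟩
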